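/- Suppose F is nondegenerate. Then for every integer k, the sum of b_ℓ over all integers ℓ ≥ 0 with ℓ ≡ k (mod d) equals d^n. (This sum is finite, since b_ℓ = 0 for ℓ > (n+1)(d−1).) -/

import Mathlib

noncomputable section

open MvPolynomial

/-- `b_ℓ := dim_K K[x]_ℓ / (I_F)_ℓ`, the dimension of the degree-`ℓ` graded piece of the
quotient of `K[x_0,…,x_n]` by the ideal `I_F = ⟨∂_0F, …, ∂_nF⟩`, where `∂_i = x_i ∂/∂x_i`. -/
def bdim {K : Type*} [Field K] {n : ℕ} (F : MvPolynomial (Fin (n + 1)) K) (ℓ : ℕ) : ℕ :=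
  Module.finrank K
    (Submodule.map
      (Ideal.Quotient.mkₐ K
        (Ideal.span (Set.range fun i => X i * pderiv i F))).toLinearMap
      (homogeneousSubmodule (Fin (n + 1)) K ℓ))

/-- The list `ps` is a weakly regular sequence on `R ⧸ J`. -/
def IsRegularSeqMod {R : Type*} [CommRing R] : Ideal R → List R → Prop
  | _, [] => True
  | J, p :: ps => (∀ f, p * f ∈ J → f ∈ J) ∧ IsRegularSeqMod (J ⊔ Ideal.span {p}) ps

/-- `g` is a nonzerodivisor on `R ⧸ J'` for `J'` generated by `J` and any proper initial segment
of `ps`. -/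
def IsRegularModInits {R : Type*} [CommRing R] (g : R) : Ideal R → List R → Prop
  | _, [] => True
  | J, p :: ps => (∀ f, g * f ∈ J → f ∈ J) ∧ IsRegularModInits g (J ⊔ Ideal.span {p}) ps

lemma IsRegularSeqMod.dropLast_of_isRegularModInits {R : Type*} [CommRing R] (g : R)
    (ps : List R) (J : Ideal R) (h : IsRegularSeqMod J ps) (hg : IsRegularModInits g J ps) :
    IsRegularSeqMod (J ⊔ Ideal.span {g}) ps.dropLast := by
  induction ps generalizing J with
  | nil => trivial
  | cons p ps ih =>
    cases ps with
    | nil => trivial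
    | cons q qs =>
      refine ⟨fun f hf => ?_, ?_⟩
      · obtain ⟨u, hu, v, hv, huv⟩ := Submodule.mem_sup.1 hf
        obtain ⟨b, rfl⟩ := Ideal.mem_span_singleton'.1 hv
        have hb : b ∈ J ⊔ Ideal.span {p} := hg.2.1 b <| by
          have : g * b = -u + f * p := by linear_combination huv
          rw [this]
          exact add_mem (neg_mem (Ideal.mem_sup_left hu))
            (Ideal.mem_sup_right (Ideal.mem_span_singleton'.2 ⟨f, rfl⟩))
        obtain ⟨w, hw, z, hz, rfl⟩ := Submodule.mem_sup.1 hb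
        obtain ⟨c, rfl⟩ := Ideal.mem_span_singleton'.1 hz
        have hfc : f - c * g ∈ J := h.1 _ <| by
          have : p * (f - c * g) = u + g * w := by linear_combination -huv
          rw [this]
          exact add_mem hu (J.mul_mem_left _ hw)
        rw [← sub_add_cancel f (c * g)]
        exact add_mem (Ideal.mem_sup_left hfc)
          (Ideal.mem_sup_right (Ideal.mem_span_singleton'.2 ⟨c, rfl⟩))
      · rw [sup_right_comm]
        exact ih _ h.2 hg.2

lemma Ideal.mem_of_mul_mem_of_forall_notMem_associatedPrimes {R : Type*} [CommRing R]
    [IsNoetherianRing R] {J : Ideal R} {g : R}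
    (hg : ∀ P ∈ associatedPrimes R (R ⧸ J), g ∉ P) (f : R) (hf : g * f ∈ J) : f ∈ J := by
  by_contra hfJ
  have hmem : g ∈ ⋃ p ∈ associatedPrimes R (R ⧸ J), (p : Set R) := by
    rw [biUnion_associatedPrimes_eq_zero_divisors]
    refine ⟨Ideal.Quotient.mk J f, by rwa [Ne, Ideal.Quotient.eq_zero_iff_mem], ?_⟩
    rwa [Algebra.smul_def, Ideal.Quotient.algebraMap_eq, ← map_mul, Ideal.Quotient.eq_zero_iff_mem]
  obtain ⟨P, hP, hgP⟩ := Set.mem_iUnion₂.1 hmem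
  exact hg P hP hgP

lemma Ideal.notMem_associatedPrimes_of_regular {R : Type*} [CommRing R]
    [IsNoetherianRing R] {J : Ideal R} {p : R} (hp : ∀ f, p * f ∈ J → f ∈ J) {P : Ideal R}
    (hP : P ∈ associatedPrimes R (R ⧸ J)) : p ∉ P := by
  intro hpP
  have hmem : p ∈ ⋃ p ∈ associatedPrimes R (R ⧸ J), (p : Set R) := Set.mem_iUnion₂.2 ⟨P, hP, hpP⟩
  rw [biUnion_associatedPrimes_eq_zero_divisors] at hmem
  obtain ⟨x, hx, hpx⟩ := hmem
  obtain ⟨f, rfl⟩ := Ideal.Quotient.mk_surjective x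
  rw [Algebra.smul_def, Ideal.Quotient.algebraMap_eq, ← map_mul,
    Ideal.Quotient.eq_zero_iff_mem] at hpx
  exact hx (Ideal.Quotient.eq_zero_iff_mem.2 (hp f hpx))

lemma IsRegularSeqMod.exists_finset_isRegularModInits {R : Type*} [CommRing R]
    [IsNoetherianRing R] (I : Ideal R) (ps : List R) (J : Ideal R) (hI : ∀ p ∈ ps, p ∈ I)
    (h : IsRegularSeqMod J ps) :
    ∃ T : Finset (Ideal R), (∀ P ∈ T, ¬ I ≤ P) ∧
      ∀ g, (∀ P ∈ T, g ∉ P) → IsRegularModInits g J ps := by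
  classical
  induction ps generalizing J with
  | nil => exact ⟨∅, by simp, fun _ _ => trivial⟩
  | cons p ps ih =>
    obtain ⟨T, hT, hTg⟩ := ih (J ⊔ Ideal.span {p}) (fun q hq => hI q (List.mem_cons_of_mem _ hq)) h.2
    refine ⟨(associatedPrimes.finite R (R ⧸ J)).toFinset ∪ T, fun P hP hIP => ?_,
      fun g hg => ⟨?_, hTg g fun P hP => hg P (Finset.mem_union_right _ hP)⟩⟩
    · rcases Finset.mem_union.1 hP with hP | hP
      · exact Ideal.notMem_associatedPrimes_of_regular h.1 ((Set.Finite.mem_toFinset _).1 hP)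
          (hIP (hI p List.mem_cons_self))
      · exact hT P hP hIP
    · exact Ideal.mem_of_mul_mem_of_forall_notMem_associatedPrimes fun P hP =>
        hg P (Finset.mem_union_left _ ((Set.Finite.mem_toFinset _).2 hP))

lemma Submodule.exists_mem_forall_notMem_ideal {K R : Type*} [Field K] [Infinite K] [CommRing R]
    [Algebra K R] (V : Submodule K R) (T : Finset (Ideal R))
    (hT : ∀ P ∈ T, ¬ Ideal.span (V : Set R) ≤ P) : ∃ g ∈ V, ∀ P ∈ T, g ∉ P := by
  classical
  have hne := Subspace.biUnion_ne_univ_of_top_notMem (k := K) (E := V)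
    (s := T.image fun P => (P.restrictScalars K).comap V.subtype) <| by
      rw [Finset.mem_image]
      rintro ⟨P, hP, htop⟩
      refine hT P hP (Ideal.span_le.2 fun v hv => ?_)
      have : (⟨v, hv⟩ : V) ∈ (P.restrictScalars K).comap V.subtype := htop ▸ Submodule.mem_top
      simpa using this
  obtain ⟨g, hg⟩ := (Set.ne_univ_iff_exists_notMem _).1 hne
  refine ⟨g, g.2, fun P hP hgP => hg (Set.mem_iUnion₂.2 ⟨_, Finset.mem_image_of_mem _ hP, ?_⟩)⟩
  simpa using hgP

/-- If the ideal generated by a subspace `V` contains a regular sequence on `R ⧸ J`, then `V`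
contains a regular sequence on `R ⧸ J` of the same length. -/
lemma IsRegularSeqMod.exists_mem_subspace {K R : Type*} [Field K] [Infinite K] [CommRing R]
    [Algebra K R] [IsNoetherianRing R] (V : Submodule K R) (m : ℕ) (ps : List R) (J : Ideal R)
    (hm : ps.length = m) (hps : ∀ p ∈ ps, p ∈ Ideal.span (V : Set R)) (h : IsRegularSeqMod J ps) :
    ∃ gs : List R, gs.length = m ∧ (∀ g ∈ gs, g ∈ V) ∧ IsRegularSeqMod J gs := by
  induction m generalizing ps J with
  | zero => exact ⟨[], rfl, by simp, trivial⟩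
  | succ m ih =>
    obtain ⟨T, hT, hTg⟩ := h.exists_finset_isRegularModInits _ ps J hps
    obtain ⟨g, hgV, hg⟩ := V.exists_mem_forall_notMem_ideal T hT
    have hreg := hTg g hg
    obtain ⟨gs, hlen, hgs, hgsreg⟩ := ih ps.dropLast (J ⊔ Ideal.span {g}) (by simp [hm])
      (fun p hp => hps p (List.mem_of_mem_dropLast hp))
      (h.dropLast_of_isRegularModInits g ps J hreg)
    refine ⟨g :: gs, by simp [hlen], by simpa [hgV] using hgs, ?_, hgsreg⟩
    cases ps with
    | nil => simp at hm
    | cons p ps => exact hreg.1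

/-- The subspace spanned by `W ≤ J` and a regular sequence on `R ⧸ J` has the expected
dimension. -/
lemma IsRegularSeqMod.finrank_add_length_le {K R : Type*} [Field K] [CommRing R]
    [Algebra K R] (V : Submodule K R) [FiniteDimensional K V] {I : Ideal R} (hI : I ≠ ⊤)
    (hVI : ∀ v ∈ V, v ∈ I) (gs : List R) (hgs : ∀ g ∈ gs, g ∈ V) (J : Ideal R) (hJI : J ≤ I)
    (W : Submodule K R) (hWV : W ≤ V) (hWJ : ∀ w ∈ W, w ∈ J) (h : IsRegularSeqMod J gs) :
    Module.finrank K W + gs.length ≤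
      Module.finrank K (W ⊔ Submodule.span K {g | g ∈ gs} : Submodule K R) := by
  induction gs generalizing J W with
  | nil => 
    rw [show {g : R | g ∈ ([] : List R)} = ∅ by ext; simp, Submodule.span_empty, sup_bot_eq]
    simp
  | cons g gs ih =>
    have hgV : g ∈ V := hgs g List.mem_cons_self
    have hgJ : g ∉ J := fun hgJ => hI <| (Ideal.eq_top_iff_one _).2 <|
      hJI <| h.1 1 (by simpa using hgJ)
    have hgW : g ∉ W := fun hgW => hgJ (hWJ g hgW)
    have hle : W ⊔ Submodule.span K {g} ≤ V :=
      sup_le hWV ((Submodule.span_singleton_le_iff_mem _ _).2 hgV)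
    have hfin : FiniteDimensional K ↥(W ⊔ Submodule.span K {g}) :=
      Submodule.finiteDimensional_of_le hle
    have hlt : Module.finrank K W < Module.finrank K ↥(W ⊔ Submodule.span K {g}) := by
      refine Submodule.finrank_lt_finrank_of_lt (lt_of_le_of_ne le_sup_left fun heq => hgW ?_)
      rw [heq]
      exact Submodule.mem_sup_right (Submodule.mem_span_singleton_self g)
    have := ih (fun q hq => hgs q (List.mem_cons_of_mem _ hq)) (J ⊔ Ideal.span {g})
      (sup_le hJI ((Ideal.span_singleton_le_iff_mem _).2 (hVI g hgV)))
      (W ⊔ Submodule.span K {g}) hle (fun w hw => ?_) h.2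
    · have hset : {q | q ∈ g :: gs} = {g} ∪ {q | q ∈ gs} := by ext; simp
      rw [hset, Submodule.span_union, ← sup_assoc]
      simp only [List.length_cons]
      omega
    · obtain ⟨a, ha, b, hb, rfl⟩ := Submodule.mem_sup.1 hw
      obtain ⟨c, rfl⟩ := Submodule.mem_span_singleton.1 hb
      exact add_mem (Ideal.mem_sup_left (hWJ a ha)) (Ideal.mem_sup_right
        (Submodule.smul_of_tower_mem _ c (Ideal.mem_span_singleton_self g)))

/-- The Hilbert function of `K[σ] ⧸ J`. -/
def hilbertFun {K σ : Type*} [Field K] (J : Ideal (MvPolynomial σ K)) (ℓ : ℕ) : ℕ :=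
  Module.finrank K (Submodule.map (Ideal.Quotient.mkₐ K J).toLinearMap (homogeneousSubmodule σ K ℓ))

/-- `J` contains the homogeneous components of its elements. -/
def HasComponents {K σ : Type*} [Field K] (J : Ideal (MvPolynomial σ K)) : Prop :=
  ∀ f ∈ J, ∀ ℓ, homogeneousComponent ℓ f ∈ J

instance finite_homogeneousSubmodule {K σ : Type*} [Field K] [Finite σ] (ℓ : ℕ) :
    Module.Finite K (homogeneousSubmodule σ K ℓ) :=
  Module.Finite.iff_fg.2 (homogeneousSubmodule_fg σ K ℓ)

lemma hilbertFun_add_finrank {K σ : Type*} [Field K] [Finite σ] (J : Ideal (MvPolynomial σ K))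
    (ℓ : ℕ) :
    hilbertFun J ℓ +
      Module.finrank K (J.restrictScalars K ⊓ homogeneousSubmodule σ K ℓ : Submodule K _) =
      Module.finrank K (homogeneousSubmodule σ K ℓ) := by
  have h := ((Ideal.Quotient.mkₐ K J).toLinearMap.domRestrict
    (homogeneousSubmodule σ K ℓ)).finrank_range_add_finrank_ker
  rw [LinearMap.range_domRestrict, LinearMap.ker_domRestrict] at h
  have hker : LinearMap.ker (Ideal.Quotient.mkₐ K J).toLinearMap = J.restrictScalars K := by
    ext f
    simp [Ideal.Quotient.eq_zero_iff_mem]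
  rw [← h, hilbertFun, (Submodule.equivMapOfInjective _ (Submodule.subtype_injective _)
    (Submodule.comap _ _)).finrank_eq, Submodule.map_comap_subtype, inf_comm, hker]

lemma homogeneousComponent_mul_of_isHomogeneous {K σ : Type*} [Field K] {d : ℕ}
    {g : MvPolynomial σ K} (hg : g.IsHomogeneous d) (f : MvPolynomial σ K) (ℓ : ℕ) :
    homogeneousComponent ℓ (f * g) =
      if d ≤ ℓ then homogeneousComponent (ℓ - d) f * g else 0 := by
  have hsum : f * g = ∑ i ∈ Finset.range (f.totalDegree + 1), homogeneousComponent i f * g := by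
    rw [← Finset.sum_mul, sum_homogeneousComponent]
  have hcomp (i : ℕ) : homogeneousComponent ℓ (homogeneousComponent i f * g) =
      if i + d = ℓ then homogeneousComponent i f * g else 0 := by
    rw [homogeneousComponent_of_mem ((homogeneousComponent_isHomogeneous i f).mul hg)]
    simp [eq_comm]
  rw [hsum, map_sum]
  simp_rw [hcomp]
  split_ifs with h
  · rw [Finset.sum_eq_single (ℓ - d)]
    · rw [if_pos (by omega)]
    · intro i _ hi
      rw [if_neg (by omega)]
    · intro hi
      rw [if_pos (by omega), homogeneousComponent_eq_zero, zero_mul]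
      simp only [Finset.mem_range] at hi
      omega
  · exact Finset.sum_eq_zero fun i _ => if_neg (by omega)

lemma HasComponents.sup_span_singleton {K σ : Type*} [Field K] {J : Ideal (MvPolynomial σ K)}
    (hJ : HasComponents J) {d : ℕ} {g : MvPolynomial σ K} (hg : g.IsHomogeneous d) :
    HasComponents (J ⊔ Ideal.span {g}) := by
  intro f hf ℓ
  obtain ⟨a, ha, b, hb, rfl⟩ := Submodule.mem_sup.1 hf
  obtain ⟨c, rfl⟩ := Ideal.mem_span_singleton'.1 hb
  rw [map_add, homogeneousComponent_mul_of_isHomogeneous hg]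
  refine add_mem (Ideal.mem_sup_left (hJ a ha ℓ)) (Ideal.mem_sup_right ?_)
  split_ifs
  · exact Ideal.mul_mem_left _ _ (Ideal.mem_span_singleton_self g)
  · exact zero_mem _

lemma hilbertFun_sup_span_singleton_of_lt {K σ : Type*} [Field K] [Finite σ]
    {J : Ideal (MvPolynomial σ K)} (hJ : HasComponents J) {d : ℕ} {g : MvPolynomial σ K}
    (hg : g.IsHomogeneous d) {ℓ : ℕ} (hℓ : ℓ < d) :
    hilbertFun (J ⊔ Ideal.span {g}) ℓ = hilbertFun J ℓ := by
  have h : (J ⊔ Ideal.span {g}).restrictScalars K ⊓ homogeneousSubmodule σ K ℓ =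
      J.restrictScalars K ⊓ homogeneousSubmodule σ K ℓ := by
    ext f
    simp only [Submodule.mem_inf, Submodule.restrictScalars_mem, mem_homogeneousSubmodule,
      and_congr_left_iff]
    refine fun hfℓ => ⟨fun hf => ?_, fun hf => Ideal.mem_sup_left hf⟩
    obtain ⟨a, ha, b, hb, rfl⟩ := Submodule.mem_sup.1 hf
    obtain ⟨c, rfl⟩ := Ideal.mem_span_singleton'.1 hb
    rw [← homogeneousComponent_eq_self hfℓ, map_add, homogeneousComponent_mul_of_isHomogeneous hg,
      if_neg (by omega), add_zero]
    exact hJ a ha ℓ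
  have h1 := hilbertFun_add_finrank J ℓ
  have h2 := hilbertFun_add_finrank (J ⊔ Ideal.span {g}) ℓ
  rw [h] at h2
  omega

lemma hilbertFun_sup_span_singleton_add {K σ : Type*} [Field K] [Finite σ]
    {J : Ideal (MvPolynomial σ K)} (hJ : HasComponents J) {d : ℕ} {g : MvPolynomial σ K}
    (hg : g.IsHomogeneous d) (hg0 : g ≠ 0) (hreg : ∀ f, g * f ∈ J → f ∈ J) (ℓ : ℕ) :
    hilbertFun (J ⊔ Ideal.span {g}) (ℓ + d) + hilbertFun J ℓ = hilbertFun J (ℓ + d) := by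
  let μ : MvPolynomial σ K →ₗ[K] MvPolynomial σ K := LinearMap.mulRight K g
  have hμ : Function.Injective μ := fun a b hab => mul_right_cancel₀ hg0 hab
  let A := J.restrictScalars K ⊓ homogeneousSubmodule σ K (ℓ + d)
  let B := (homogeneousSubmodule σ K ℓ).map μ
  have hsup : (J ⊔ Ideal.span {g}).restrictScalars K ⊓ homogeneousSubmodule σ K (ℓ + d) =
      A ⊔ B := by
    apply le_antisymm
    · rintro f ⟨hf, hfℓ⟩
      obtain ⟨a, ha, b, hb, rfl⟩ := Submodule.mem_sup.1 hf
      obtain ⟨c, rfl⟩ := Ideal.mem_span_singleton'.1 hb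
      rw [← homogeneousComponent_eq_self hfℓ, map_add,
        homogeneousComponent_mul_of_isHomogeneous hg, if_pos (by omega), Nat.add_sub_cancel]
      exact Submodule.add_mem_sup
        ⟨hJ a ha _, homogeneousComponent_isHomogeneous _ _⟩
        ⟨_, homogeneousComponent_isHomogeneous _ _, rfl⟩
    · refine sup_le (fun f hf => ⟨Ideal.mem_sup_left hf.1, hf.2⟩) ?_
      rintro _ ⟨f, hf, rfl⟩
      exact ⟨Ideal.mem_sup_right (Ideal.mem_span_singleton'.2 ⟨f, rfl⟩),
        IsHomogeneous.mul hf hg⟩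
  have hinf : A ⊓ B = (J.restrictScalars K ⊓ homogeneousSubmodule σ K ℓ).map μ := by
    apply le_antisymm
    · rintro _ ⟨hA, f, hf, rfl⟩
      exact ⟨f, ⟨hreg f (by rw [mul_comm]; exact hA.1), hf⟩, rfl⟩
    · rintro _ ⟨f, hf, rfl⟩
      exact ⟨⟨J.mul_mem_right g hf.1, IsHomogeneous.mul hf.2 hg⟩, f, hf.2, rfl⟩
  have hfinA : FiniteDimensional K A := Submodule.finiteDimensional_of_le inf_le_right
  have hdim := Submodule.finrank_sup_add_finrank_inf_eq A B
  rw [← hsup, hinf, ← (Submodule.equivMapOfInjective μ hμ _).finrank_eq,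
    ← (Submodule.equivMapOfInjective μ hμ _).finrank_eq] at hdim
  have h1 := hilbertFun_add_finrank J ℓ
  have h2 := hilbertFun_add_finrank J (ℓ + d)
  have h3 := hilbertFun_add_finrank (J ⊔ Ideal.span {g}) (ℓ + d)
  simp only [A] at hdim
  omega

/-- The Hilbert series of `K[σ] ⧸ J`. -/
def hilbertSeries {K σ : Type*} [Field K] (J : Ideal (MvPolynomial σ K)) : PowerSeries ℤ :=
  PowerSeries.mk fun ℓ => (hilbertFun J ℓ : ℤ)

lemma hilbertSeries_sup_span_singleton {K σ : Type*} [Field K] [Finite σ]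
    {J : Ideal (MvPolynomial σ K)} (hJ : HasComponents J) {d : ℕ} {g : MvPolynomial σ K}
    (hg : g.IsHomogeneous d) (hg0 : g ≠ 0) (hreg : ∀ f, g * f ∈ J → f ∈ J) :
    hilbertSeries (J ⊔ Ideal.span {g}) = (1 - PowerSeries.X ^ d) * hilbertSeries J := by
  ext ℓ
  rw [sub_mul, one_mul, map_sub, PowerSeries.coeff_X_pow_mul']
  simp only [hilbertSeries, PowerSeries.coeff_mk]
  split_ifs with h
  · obtain ⟨m, rfl⟩ := Nat.exists_eq_add_of_le' h
    rw [Nat.add_sub_cancel, ← hilbertFun_sup_span_singleton_add hJ hg hg0 hreg m]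
    push_cast
    ring
  · rw [hilbertFun_sup_span_singleton_of_lt hJ hg (by omega), sub_zero]

lemma hilbertSeries_bot {K : Type*} [Field K] (n : ℕ) :
    hilbertSeries (⊥ : Ideal (MvPolynomial (Fin (n + 1)) K)) = (PowerSeries.mk 1) ^ (n + 1) := by
  rw [PowerSeries.mk_one_pow_eq_mk_choose_add]
  ext ℓ
  simp only [hilbertSeries, PowerSeries.coeff_mk]
  have h := hilbertFun_add_finrank (⊥ : Ideal (MvPolynomial (Fin (n + 1)) K)) ℓ
  have hbot : ((⊥ : Ideal (MvPolynomial (Fin (n + 1)) K)).restrictScalars K ⊓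
      homogeneousSubmodule (Fin (n + 1)) K ℓ) = ⊥ := by simp
  rw [hbot, finrank_bot, add_zero] at h
  rw [h, homogeneousSubmodule_eq_finsupp_supported]
  have hcard : Nat.card {m : Fin (n + 1) →₀ ℕ | m.degree = ℓ} = (n + ℓ).choose n := by
    rw [Nat.choose_symm_add, show n + ℓ = n + 1 + ℓ - 1 by omega]
    have := Finset.card_finsuppAntidiag_nat_eq_choose (s := (Finset.univ : Finset (Fin (n + 1)))) ℓ
    rw [Finset.card_univ, Fintype.card_fin] at this
    rw [← this, ← Nat.card_eq_finsetCard]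
    refine Nat.card_congr (Equiv.subtypeEquivRight fun m => ?_)
    simp [Finset.mem_finsuppAntidiag, Finsupp.degree_eq_sum]
  have hfin : Finite {m : Fin (n + 1) →₀ ℕ | m.degree = ℓ} := Nat.finite_of_card_ne_zero <| by
    rw [hcard]
    exact (Nat.choose_pos (by omega)).ne'
  have := Fintype.ofFinite {m : Fin (n + 1) →₀ ℕ | m.degree = ℓ}
  rw [(AddMonoidAlgebra.supportedEquivFinsupp _).finrank_eq, Module.finrank_finsupp_self,
    ← Nat.card_eq_fintype_card, hcard]

/-- The Hilbert series of a complete intersection of forms of degree `d`. -/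
lemma hilbertSeries_sup_span_of_isRegularSeqMod {K σ : Type*} [Field K] [Finite σ] {d : ℕ}
    {I : Ideal (MvPolynomial σ K)} (hI : I ≠ ⊤) (gs : List (MvPolynomial σ K))
    (hgs : ∀ g ∈ gs, g.IsHomogeneous d) (hgI : ∀ g ∈ gs, g ∈ I)
    (J : Ideal (MvPolynomial σ K)) (hJ : HasComponents J) (hJI : J ≤ I)
    (h : IsRegularSeqMod J gs) :
    hilbertSeries (J ⊔ Ideal.span {g | g ∈ gs}) =
      (1 - PowerSeries.X ^ d) ^ gs.length * hilbertSeries J := by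
  induction gs generalizing J with
  | nil =>
    rw [show {g | g ∈ ([] : List (MvPolynomial σ K))} = ∅ by ext; simp, Ideal.span_empty,
      sup_bot_eq]
    simp
  | cons g gs ih =>
    have hg := hgs g List.mem_cons_self
    have hg0 : g ≠ 0 := by
      rintro rfl
      exact hI ((Ideal.eq_top_iff_one _).2 (hJI (h.1 1 (by simp))))
    have hset : {q | q ∈ g :: gs} = {g} ∪ {q | q ∈ gs} := by ext; simp
    rw [hset, Ideal.span_union, ← sup_assoc,
      ih (fun q hq => hgs q (List.mem_cons_of_mem _ hq))
        (fun q hq => hgI q (List.mem_cons_of_mem _ hq)) _ (hJ.sup_span_singleton hg)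
        (sup_le hJI ((Ideal.span_singleton_le_iff_mem _).2 (hgI g List.mem_cons_self))) h.2,
      hilbertSeries_sup_span_singleton hJ hg hg0 h.1, List.length_cons, pow_succ, mul_assoc]

lemma isRegularSeqMod_X_pow {K σ : Type*} [Field K] (N : ℕ) (l : List σ) (s : Set σ)
    (hl : l.Nodup) (hs : ∀ i ∈ l, i ∉ s) :
    IsRegularSeqMod (Ideal.span ((fun m => monomial m (1 : K)) '' ((Finsupp.single · N) '' s)))
      (l.map fun i => X i ^ N) := by
  induction l generalizing s with
  | nil => trivial
  | cons i l ih =>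
    rw [List.nodup_cons] at hl
    refine ⟨fun f hf => ?_, ?_⟩
    · rw [mem_ideal_span_monomial_image] at hf ⊢
      intro m hm
      obtain ⟨_, ⟨j, hj, rfl⟩, hjm⟩ := hf (Finsupp.single i N + m) <| by
        change _ ∈ (X i ^ N * f).support
        rw [X_pow_eq_monomial, mem_support_iff, coeff_monomial_mul, one_mul]
        exact mem_support_iff.1 hm
      have hij : i ≠ j := fun h => hs i List.mem_cons_self (h ▸ hj)
      refine ⟨_, ⟨j, hj, rfl⟩, ?_⟩
      rw [Finsupp.single_le_iff] at hjm ⊢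
      simpa [Finsupp.single_apply, hij] using hjm
    · have := ih (insert i s) hl.2 (fun j hj => ?_)
      · rw [Set.image_insert_eq, Set.image_insert_eq, Ideal.span_insert, sup_comm,
          ← X_pow_eq_monomial] at this
        exact this
      · rintro (rfl | hjs)
        · exact hl.1 hj
        · exact hs j (List.mem_cons_of_mem _ hj) hjs

lemma hasComponents_bot {K σ : Type*} [Field K] :
    HasComponents (⊥ : Ideal (MvPolynomial σ K)) := by
  intro f hf ℓ
  rw [Ideal.mem_bot] at hf ⊢
  rw [hf, map_zero]

lemma hasComponents_span_range {K σ ι : Type*} [Field K] [Finite ι] {d : ℕ}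
    {f : ι → MvPolynomial σ K} (hf : ∀ i, (f i).IsHomogeneous d) :
    HasComponents (Ideal.span (Set.range f)) := by
  intro g hg
  induction hg using Submodule.span_induction with
  | mem g hg =>
    obtain ⟨i, rfl⟩ := hg
    intro ℓ
    rw [homogeneousComponent_of_mem (hf i)]
    split_ifs
    · exact Ideal.subset_span ⟨i, rfl⟩
    · exact zero_mem _
  | zero => simp
  | add a b _ _ ha hb => exact fun ℓ => by rw [map_add]; exact add_mem (ha ℓ) (hb ℓ)
  | smul a g _ hg =>
    intro ℓ
    rw [smul_eq_mul, ← sum_homogeneousComponent a, Finset.sum_mul, map_sum]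
    refine sum_mem fun i _ => ?_
    rw [mul_comm,
      homogeneousComponent_mul_of_isHomogeneous (homogeneousComponent_isHomogeneous i a)]
    split_ifs
    · exact Ideal.mul_mem_right _ _ (hg _)
    · exact zero_mem _

/-- A projective Nullstellensatz. -/
lemma exists_X_pow_mem_of_forall_eval_eq_zero {L σ : Type*} [Field L] [IsAlgClosed L] [Finite σ]
    (I : Ideal (MvPolynomial σ L))
    (h : ∀ x : σ → L, (∀ f ∈ I, eval x f = 0) → x = 0) : ∃ N : ℕ, ∀ i, X i ^ N ∈ I := by
  have := Fintype.ofFinite σ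
  have hrad (i : σ) : ∃ N : ℕ, X i ^ N ∈ I := by
    rw [← Ideal.mem_radical_iff, ← vanishingIdeal_zeroLocus_eq_radical (K := L),
      mem_vanishingIdeal_iff]
    intro x hx
    rw [mem_zeroLocus_iff] at hx
    rw [h x fun f hf => by simpa [aeval_eq_eval] using hx f hf]
    simp
  choose N hN using hrad
  exact ⟨∑ i, N i, fun i => I.pow_mem_of_pow_mem (hN i)
    (Finset.single_le_sum (fun _ _ => Nat.zero_le _) (Finset.mem_univ i))⟩

lemma one_sub_X_pow_mul_mk_one (d : ℕ) :
    (1 - PowerSeries.X ^ d : PowerSeries ℤ) * PowerSeries.mk 1 =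
      ∑ i ∈ Finset.range d, PowerSeries.X ^ i := by
  rw [← mul_neg_geom_sum, mul_right_comm, mul_comm (1 - PowerSeries.X),
    PowerSeries.mk_one_mul_one_sub_eq_one, one_mul]

/-- Forms of degree `d` in `n + 1` variables without a common projective zero form a complete
intersection. -/
lemma hilbertSeries_span_range_of_isAlgClosed {L : Type*} [Field L] [IsAlgClosed L] {n d : ℕ}
    (hd : d ≠ 0) (f : Fin (n + 1) → MvPolynomial (Fin (n + 1)) L)
    (hf : ∀ i, (f i).IsHomogeneous d) (h : ∀ x, (∀ i, eval x (f i) = 0) → x = 0) :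
    hilbertSeries (Ideal.span (Set.range f)) =
      (∑ i ∈ Finset.range d, PowerSeries.X ^ i) ^ (n + 1) := by
  set I := Ideal.span (Set.range f) with hIdef
  let V := Submodule.span L (Set.range f)
  have hVhom : ∀ v ∈ V, v.IsHomogeneous d := by
    have : V ≤ homogeneousSubmodule _ L d := Submodule.span_le.2 (by rintro _ ⟨i, rfl⟩; exact hf i)
    exact this
  have hVI : ∀ v ∈ V, v ∈ I := by
    have : V ≤ I.restrictScalars L :=
      Submodule.span_le.2 (by rintro _ ⟨i, rfl⟩; exact Ideal.subset_span ⟨i, rfl⟩)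
    exact this
  have hspanV : Ideal.span (V : Set (MvPolynomial (Fin (n + 1)) L)) = I :=
    le_antisymm (Ideal.span_le.2 hVI) (Ideal.span_mono Submodule.subset_span)
  have hI : I ≠ ⊤ := by
    have hle : I ≤ RingHom.ker (eval (0 : Fin (n + 1) → L)) := by
      rw [hIdef, Ideal.span_le]
      rintro _ ⟨i, rfl⟩
      have := (hf i).coeff_eq_zero (d := 0) (by simpa using hd.symm)
      simpa [← constantCoeff_eq, RingHom.mem_ker] using this
    intro htop
    rw [htop, top_le_iff] at hle
    exact RingHom.ker_ne_top _ hle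
  obtain ⟨N, hN⟩ := exists_X_pow_mem_of_forall_eval_eq_zero I fun x hx =>
    h x fun i => hx _ (Ideal.subset_span ⟨i, rfl⟩)
  have hps := isRegularSeqMod_X_pow (K := L) N (List.finRange (n + 1)) ∅ (List.nodup_finRange _)
    (by simp)
  simp only [Set.image_empty, Ideal.span_empty] at hps
  obtain ⟨gs, hlen, hgsV, hreg⟩ := hps.exists_mem_subspace V (n + 1) _ _ (by simp)
    (by rw [hspanV]; simpa using hN)
  have hfin : FiniteDimensional L V := FiniteDimensional.span_of_finite L (Set.finite_range f)
  have hle : Submodule.span L {g | g ∈ gs} ≤ V := Submodule.span_le.2 hgsV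
  have hdim := hreg.finrank_add_length_le V hI hVI gs hgsV ⊥ bot_le ⊥ bot_le (by simp)
  rw [finrank_bot, zero_add, bot_sup_eq, hlen] at hdim
  have hspan : Submodule.span L {g | g ∈ gs} = V := by
    refine Submodule.eq_of_le_of_finrank_le hle (le_trans ?_ hdim)
    have := finrank_range_le_card (R := L) f
    rwa [Fintype.card_fin] at this
  have hgsI : Ideal.span {g | g ∈ gs} = I := by
    refine le_antisymm (Ideal.span_le.2 fun g hg => hVI g (hgsV g hg)) ?_
    rw [← hspanV, ← hspan]
    exact Ideal.span_le.2 (Submodule.span_le_restrictScalars L _ _)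
  have hseries := hilbertSeries_sup_span_of_isRegularSeqMod hI gs (fun g hg => hVhom g (hgsV g hg))
    (fun g hg => hVI g (hgsV g hg)) ⊥ hasComponents_bot bot_le hreg
  rw [bot_sup_eq, hgsI, hlen, hilbertSeries_bot, ← mul_pow, one_sub_X_pow_mul_mk_one] at hseries
  exact hseries

lemma linearIndependent_map_mvPolynomial {K L σ ι : Type*} [Field K] [Field L] [Algebra K L]
    {v : ι → MvPolynomial σ K} (hv : LinearIndependent K v) :
    LinearIndependent L fun i => map (algebraMap K L) (v i) := by
  rw [linearIndependent_iff'] at hv ⊢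
  intro s c hc i hi
  refine (Module.forall_dual_apply_eq_zero_iff K _).1 fun φ => ?_
  refine hv s (fun j => φ (c j)) ?_ i hi
  ext m
  have hm := congrArg φ (congrArg (coeff m) hc)
  simp only [coeff_sum, coeff_smul, coeff_map, smul_eq_mul, coeff_zero, map_sum, map_zero] at hm ⊢
  rw [← hm]
  refine Finset.sum_congr rfl fun j _ => ?_
  rw [mul_comm (c j), ← Algebra.smul_def, map_smul, smul_eq_mul, mul_comm]

lemma finrank_span_map_mvPolynomial {K L σ : Type*} [Field K] [Field L] [Algebra K L]
    (U : Submodule K (MvPolynomial σ K)) [FiniteDimensional K U] :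
    Module.finrank L (Submodule.span L (map (algebraMap K L) '' (U : Set (MvPolynomial σ K)))) =
      Module.finrank K U := by
  let b := Module.finBasis K U
  have hb : LinearIndependent K fun i => (b i : MvPolynomial σ K) :=
    b.linearIndependent.map' U.subtype U.ker_subtype
  have hli := linearIndependent_map_mvPolynomial (L := L) hb
  have hspan : Submodule.span L (map (algebraMap K L) '' (U : Set (MvPolynomial σ K))) =
      Submodule.span L (Set.range fun i => map (algebraMap K L) (b i : MvPolynomial σ K)) := by
    refine le_antisymm (Submodule.span_le.2 ?_) (Submodule.span_mono ?_)
    · rintro _ ⟨u, hu, rfl⟩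
      have hsum : _ = u := congrArg Subtype.val (b.sum_repr ⟨u, hu⟩)
      rw [← hsum, SetLike.mem_coe]
      simp only [Submodule.coe_sum, Submodule.coe_smul, map_sum]
      refine sum_mem fun i _ => ?_
      rw [smul_eq_C_mul, map_mul, map_C, ← smul_eq_C_mul]
      exact Submodule.smul_mem _ _ (Submodule.subset_span ⟨i, rfl⟩)
    · rintro _ ⟨i, rfl⟩
      exact ⟨b i, (b i).2, rfl⟩
  rw [hspan, finrank_span_eq_card hli, Fintype.card_fin]

lemma mem_map_iff_mem_span {K L σ : Type*} [Field K] [Field L] [Algebra K L]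
    (I : Ideal (MvPolynomial σ K)) (f : MvPolynomial σ L) :
    f ∈ I.map (map (algebraMap K L)) ↔
      f ∈ Submodule.span L (map (algebraMap K L) '' (I : Set (MvPolynomial σ K))) := by
  constructor
  · intro hf
    induction hf using Submodule.span_induction with
    | mem g hg => exact Submodule.subset_span hg
    | zero => exact zero_mem _
    | add a b _ _ ha hb => exact add_mem ha hb
    | smul a g hspan hg =>
      clear hspan
      rw [smul_eq_mul]
      induction hg using Submodule.span_induction with
      | mem g hg =>
        obtain ⟨u, hu, rfl⟩ := hg
        induction a using MvPolynomial.induction_on' with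
        | monomial m c =>
          rw [← mul_one c, ← smul_eq_mul c, ← smul_monomial, smul_mul_assoc]
          refine Submodule.smul_mem _ _ (Submodule.subset_span
            ⟨monomial m 1 * u, I.mul_mem_left _ hu, ?_⟩)
          rw [map_mul, map_monomial, map_one]
        | add p q hp hq => rw [add_mul]; exact add_mem hp hq
      | zero => rw [mul_zero]; exact zero_mem _
      | add x y _ _ hx hy => rw [mul_add]; exact add_mem hx hy
      | smul c x _ hx => rw [mul_smul_comm]; exact Submodule.smul_mem _ _ hx
  · intro hf
    exact Submodule.span_le_restrictScalars L (MvPolynomial σ L) _ hf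

lemma homogeneousComponent_map {K L σ : Type*} [Field K] [Field L] [Algebra K L]
    (f : MvPolynomial σ K) (ℓ : ℕ) :
    homogeneousComponent ℓ (map (algebraMap K L) f) =
      map (algebraMap K L) (homogeneousComponent ℓ f) := by
  ext m
  rw [coeff_homogeneousComponent, coeff_map, coeff_map, coeff_homogeneousComponent]
  split_ifs <;> simp

lemma restrictScalars_map_inf_homogeneousSubmodule {K L σ : Type*} [Field K] [Field L]
    [Algebra K L] {I : Ideal (MvPolynomial σ K)} (hI : HasComponents I) (ℓ : ℕ) :
    (I.map (map (algebraMap K L))).restrictScalars L ⊓ homogeneousSubmodule σ L ℓ =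
      Submodule.span L (map (algebraMap K L) ''
        ((I.restrictScalars K ⊓ homogeneousSubmodule σ K ℓ : Submodule K (MvPolynomial σ K)) :
          Set (MvPolynomial σ K))) := by
  apply le_antisymm
  · rintro f ⟨hf, hfℓ⟩
    rw [← homogeneousComponent_eq_self hfℓ]
    have hf' := (mem_map_iff_mem_span I f).1 hf
    clear hf hfℓ
    induction hf' using Submodule.span_induction with
    | mem g hg =>
      obtain ⟨u, hu, rfl⟩ := hg
      rw [homogeneousComponent_map]
      exact Submodule.subset_span
        ⟨_, ⟨hI u hu ℓ, homogeneousComponent_isHomogeneous ℓ u⟩, rfl⟩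
    | zero => rw [map_zero]; exact zero_mem _
    | add a b _ _ ha hb => rw [map_add]; exact add_mem ha hb
    | smul c x _ hx => rw [map_smul]; exact Submodule.smul_mem _ _ hx
  · refine Submodule.span_le.2 ?_
    rintro _ ⟨u, hu, rfl⟩
    exact ⟨Ideal.mem_map_of_mem _ hu.1, IsHomogeneous.map hu.2 _⟩

/-- The Hilbert function of a homogeneous ideal is invariant under field extension. -/
lemma hilbertFun_map {K : Type*} (L : Type*) {σ : Type*} [Field K] [Field L] [Algebra K L]
    [Finite σ] {I : Ideal (MvPolynomial σ K)} (hI : HasComponents I) (ℓ : ℕ) :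
    hilbertFun (I.map (map (algebraMap K L))) ℓ = hilbertFun I ℓ := by
  have hfin (J : Ideal (MvPolynomial σ K)) : FiniteDimensional K
      (J.restrictScalars K ⊓ homogeneousSubmodule σ K ℓ : Submodule K (MvPolynomial σ K)) :=
    Submodule.finiteDimensional_of_le inf_le_right
  have hrank {J : Ideal (MvPolynomial σ K)} (hJ : HasComponents J) :=
    (congrArg (fun W : Submodule L (MvPolynomial σ L) => Module.finrank L W)
      (restrictScalars_map_inf_homogeneousSubmodule (L := L) hJ ℓ)).trans
      (finrank_span_map_mvPolynomial _)
  have htop := hrank (J := ⊤) fun _ _ _ => Submodule.mem_top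
  rw [Ideal.map_top] at htop
  rw [Submodule.restrictScalars_top, Submodule.restrictScalars_top, top_inf_eq, top_inf_eq] at htop
  have h1 := hilbertFun_add_finrank I ℓ
  have h2 := hilbertFun_add_finrank (I.map (map (algebraMap K L))) ℓ
  rw [hrank hI, htop] at h2
  omega

lemma sum_range_ite_intMod_eq (d : ℕ) (hd : d ≠ 0) (k : ℤ) (m : ℕ) :
    ∑ i ∈ Finset.range d, (if ((m + i : ℕ) : ℤ) % d = k % d then (1 : ℤ) else 0) = 1 := by
  have hd' : (0 : ℤ) < d := by exact_mod_cast Nat.pos_of_ne_zero hd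
  obtain ⟨r, hr⟩ := Int.eq_ofNat_of_zero_le (Int.emod_nonneg (k - m) hd'.ne')
  have hrd : r < d := by have := Int.emod_lt_of_pos (k - m) hd'; omega
  rw [Finset.sum_eq_single r]
  · rw [if_pos]
    push_cast
    rw [show (m + r : ℤ) = m + (k - m) % d by rw [hr], Int.add_emod_emod]
    congr 1
    ring
  · intro i hi hir
    rw [if_neg]
    intro h
    apply hir
    have h' : ((i : ℤ) : ℤ) % d = (k - m) % d := by
      have := Int.ModEq.sub_right (m : ℤ) (h : ((m + i : ℕ) : ℤ) ≡ k [ZMOD d])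
      push_cast at this
      rwa [add_sub_cancel_left] at this
    rw [Int.emod_eq_of_lt (by omega) (by exact_mod_cast Finset.mem_range.1 hi), hr] at h'
    exact_mod_cast h'
  · intro h
    exact absurd (Finset.mem_range.2 hrd) h

/-- Multiplying by `1 + X + ⋯ + X ^ (d - 1)` equidistributes coefficients among the residue
classes modulo `d`. -/
lemma sum_coeff_mul_geom_sum (d : ℕ) (hd : d ≠ 0) (k : ℤ) (N : ℕ) (Q : Polynomial ℤ)
    (hN : Q.natDegree + (d - 1) ≤ N) :
    ∑ ℓ ∈ Finset.range (N + 1), (if (ℓ : ℤ) % d = k % d then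
      (Q * ∑ i ∈ Finset.range d, Polynomial.X ^ i).coeff ℓ else 0) = Q.eval 1 := by
  have hcoeff (ℓ : ℕ) : (Q * ∑ i ∈ Finset.range d, Polynomial.X ^ i).coeff ℓ =
      ∑ m ∈ Finset.range (Q.natDegree + 1), ∑ i ∈ Finset.range d,
        if ℓ = m + i then Q.coeff m else 0 := by
    conv_lhs => rw [Q.as_sum_range_C_mul_X_pow, Finset.sum_mul_sum, Polynomial.finsetSum_coeff]
    refine Finset.sum_congr rfl fun m _ => ?_
    rw [Polynomial.finsetSum_coeff]
    refine Finset.sum_congr rfl fun i _ => ?_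
    rw [mul_assoc, ← pow_add, Polynomial.coeff_C_mul_X_pow]
  have hsplit (ℓ : ℕ) : (if (ℓ : ℤ) % d = k % d then
      (Q * ∑ i ∈ Finset.range d, Polynomial.X ^ i).coeff ℓ else 0) =
      ∑ m ∈ Finset.range (Q.natDegree + 1), ∑ i ∈ Finset.range d,
        if ℓ = m + i then
          Q.coeff m * (if ((m + i : ℕ) : ℤ) % d = k % d then 1 else 0) else 0 := by
    rw [hcoeff]
    split_ifs with h
    · refine Finset.sum_congr rfl fun m _ => Finset.sum_congr rfl fun i _ => ?_
      split_ifs with h1 h2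
      · rw [mul_one]
      · exact absurd (h1 ▸ h) h2
      · rfl
    · symm
      refine Finset.sum_eq_zero fun m _ => Finset.sum_eq_zero fun i _ => ?_
      split_ifs with h1 h2
      · exact absurd (h1 ▸ h2) h
      · rw [mul_zero]
      · rfl
  simp_rw [hsplit]
  rw [Finset.sum_comm, Polynomial.eval_eq_sum_range]
  refine Finset.sum_congr rfl fun m hm => ?_
  rw [Finset.sum_comm, one_pow]
  have hinner : ∀ i ∈ Finset.range d, (∑ ℓ ∈ Finset.range (N + 1), if ℓ = m + i then
      Q.coeff m * (if ((m + i : ℕ) : ℤ) % d = k % d then 1 else 0) else 0) =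
      Q.coeff m * (if ((m + i : ℕ) : ℤ) % d = k % d then 1 else 0) := by
    intro i hi
    rw [Finset.sum_ite_eq', if_pos]
    rw [Finset.mem_range] at *
    omega
  rw [Finset.sum_congr rfl hinner, ← Finset.mul_sum, sum_range_ite_intMod_eq d hd]

/-- Corollary 3.3 (second part): if `F` is nondegenerate then for every integer `k`,
the sum of `b_ℓ` over all `ℓ ≥ 0` with `ℓ ≡ k (mod d)` equals `d^n`.  (The sum is finite
since `b_ℓ = 0` for `ℓ > (n+1)(d-1)`; we state it for every truncation at `N ≥ (n+1)(d-1)`.) -/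
theorem sum_bdim_congruence_class (K : Type*) [Field K] (n : ℕ) (hn : 1 ≤ n)
    (d : ℕ) (hd : 2 ≤ d) (hdK : (d : K) ≠ 0)
    (F : MvPolynomial (Fin (n + 1)) K) (hF : F.IsHomogeneous d)
    (hnd : ∀ x : Fin (n + 1) → AlgebraicClosure K,
      (∀ i, MvPolynomial.aeval x (X i * pderiv i F) = 0) → x = 0)
    (k : ℤ) (N : ℕ) (hN : (n + 1) * (d - 1) ≤ N) :
    (∑ ℓ ∈ Finset.range (N + 1),
        if (ℓ : ℤ) % (d : ℤ) = k % (d : ℤ) then bdim F ℓ else 0) = d ^ n := by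
  let L := AlgebraicClosure K
  let f : Fin (n + 1) → MvPolynomial (Fin (n + 1)) K := fun i => X i * pderiv i F
  have hf (i : Fin (n + 1)) : (f i).IsHomogeneous d := by
    have := (isHomogeneous_X K i).mul (hF.pderiv (i := i))
    rwa [show 1 + (d - 1) = d by omega] at this
  let G : Polynomial ℤ := ∑ i ∈ Finset.range d, Polynomial.X ^ i
  have hseries := hilbertSeries_span_range_of_isAlgClosed (L := L) (by omega)
    (fun i => map (algebraMap K L) (f i)) (fun i => (hf i).map _) fun x hx => hnd x fun i => by
      have := hx i
      rwa [eval_map, ← aeval_def] at this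
  have hb (ℓ : ℕ) : (bdim F ℓ : ℤ) = (G ^ n * G).coeff ℓ := by
    have hmap : (Ideal.span (Set.range f)).map (map (algebraMap K L)) =
        Ideal.span (Set.range fun i => map (algebraMap K L) (f i)) := by
      rw [Ideal.map_span, ← Set.range_comp]
      rfl
    have h1 : bdim F ℓ = hilbertFun (Ideal.span (Set.range f)) ℓ := rfl
    rw [h1, ← hilbertFun_map L (hasComponents_span_range hf), hmap, ← pow_succ,
      ← Polynomial.coeff_coe]
    have hG : (∑ i ∈ Finset.range d, PowerSeries.X ^ i : PowerSeries ℤ) = (G : PowerSeries ℤ) := by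
      simp only [G, ← Polynomial.coeToPowerSeries.ringHom_apply, map_sum, map_pow]
      simp
    rw [Polynomial.coe_pow, ← hG, ← hseries, hilbertSeries, PowerSeries.coeff_mk]
  have hGdeg : G.natDegree ≤ d - 1 := by
    refine Polynomial.natDegree_sum_le_of_forall_le _ _ fun i hi => ?_
    rw [Polynomial.natDegree_X_pow]
    have := Finset.mem_range.1 hi
    omega
  have hdeg : (G ^ n).natDegree + (d - 1) ≤ N := by
    refine le_trans ?_ hN
    rw [add_mul, one_mul]
    exact Nat.add_le_add_right (Polynomial.natDegree_pow_le.trans (Nat.mul_le_mul_left n hGdeg)) _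
  have hsum := sum_coeff_mul_geom_sum d (by omega) k N (G ^ n) hdeg
  have heval : (G ^ n).eval 1 = (d : ℤ) ^ n := by
    simp [G, Polynomial.eval_finsetSum]
  rw [heval] at hsum
  have hcast : ((∑ ℓ ∈ Finset.range (N + 1),
      if (ℓ : ℤ) % (d : ℤ) = k % (d : ℤ) then bdim F ℓ else 0 : ℕ) : ℤ) = (d : ℤ) ^ n := by
    rw [← hsum]
    push_cast
    refine Finset.sum_congr rfl fun ℓ _ => ?_
    rw [hb]
  exact_mod_cast hcast
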